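/- arXiv:1404.2679 — 2 statements merged into one kernel-verified Lean document; each statement's English description precedes it below -/
import Mathlib

section
/- For any mm-space X and any real numbers κ, κ' with κ > κ' > 0, one has Sep(X; κ, κ) ≤ ObsDiam(X; -κ'). -/
open MeasureTheory Filter Topology Bornology

noncomputable section

/-- The partial diameter `diam(ν; α)` of a Borel measure `ν` on `ℝ`. -/
def partialDiam (ν : Measure ℝ) (α : ℝ) : ℝ :=
  sInf {r : ℝ | ∃ A : Set ℝ, MeasurableSet A ∧ IsBounded A ∧
    ENNReal.ofReal α ≤ ν A ∧ r = Metric.diam A}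

/-- The observable diameter `ObsDiam(X; -κ)` with respect to an explicit distance `d`. -/
def obsDiam {X : Type*} [MeasurableSpace X] (d : X → X → ℝ)
    (μ : Measure X) (κ : ℝ) : ℝ :=
  sSup {r : ℝ | ∃ f : X → ℝ, Measurable f ∧ (∀ x y, |f x - f y| ≤ d x y) ∧
    r = partialDiam (μ.map f) (1 - κ)}

/-- The distance between two subsets, with respect to an explicit distance `d`. -/
def setDist' {X : Type*} (d : X → X → ℝ) (A B : Set X) : ℝ :=
  sInf {r : ℝ | ∃ x ∈ A, ∃ y ∈ B, r = d x y}

/-- The separation distance `Sep(X; κ₀, κ₁)`: the supremum of `d(A₀, A₁)` over pairs of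
Borel sets with `μ A₀ ≥ κ₀` and `μ A₁ ≥ κ₁` (zero if no such pair exists). -/
def sepTwo {X : Type*} [MeasurableSpace X] (d : X → X → ℝ) (μ : Measure X)
    (κ₀ κ₁ : ℝ) : ℝ :=
  sSup ({0} ∪ {r : ℝ | ∃ A₀ A₁ : Set X, MeasurableSet A₀ ∧ MeasurableSet A₁ ∧
    ENNReal.ofReal κ₀ ≤ μ A₀ ∧ ENNReal.ofReal κ₁ ≤ μ A₁ ∧ r = setDist' d A₀ A₁})

lemma partialDiam_nonneg_aux (ν : Measure ℝ) (α : ℝ) : 0 ≤ partialDiam ν α := by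
  apply Real.sInf_nonneg
  rintro r ⟨A, -, -, -, rfl⟩
  exact Metric.diam_nonneg

lemma exists_ball_aux {X : Type*} [MetricSpace X] [MeasurableSpace X] [BorelSpace X]
    (μ : Measure X) [IsProbabilityMeasure μ] (x₀ : X) (κ' : ℝ) (hκ' : 0 < κ') :
    ∃ n : ℕ, ENNReal.ofReal (1 - κ') ≤ μ (Metric.closedBall x₀ n) := by
  have hm : Monotone (fun n : ℕ => Metric.closedBall x₀ (n : ℝ)) := by
    intro a b hab
    exact Metric.closedBall_subset_closedBall (by exact_mod_cast hab)
  have h := tendsto_measure_iUnion_atTop (μ := μ) hm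
  rw [Metric.iUnion_closedBall_nat, measure_univ] at h
  have h1 : ENNReal.ofReal (1 - κ') < 1 := by
    rw [ENNReal.ofReal_lt_one]; linarith
  obtain ⟨n, hn⟩ := (h.eventually (lt_mem_nhds h1)).exists
  exact ⟨n, hn.le⟩

lemma mem_partial_aux {X : Type*} [MetricSpace X] [MeasurableSpace X] [BorelSpace X]
    (μ : Measure X) (x₀ : X) (κ' : ℝ) (n : ℕ)
    (hn : ENNReal.ofReal (1 - κ') ≤ μ (Metric.closedBall x₀ n))
    (f : X → ℝ) (hf : Measurable f) (hl : ∀ x y, |f x - f y| ≤ dist x y) :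
    MeasurableSet (Metric.closedBall (f x₀) (n : ℝ)) ∧
      IsBounded (Metric.closedBall (f x₀) (n : ℝ)) ∧
      ENNReal.ofReal (1 - κ') ≤ μ.map f (Metric.closedBall (f x₀) (n : ℝ)) := by
  refine ⟨measurableSet_closedBall, Metric.isBounded_closedBall, ?_⟩
  rw [Measure.map_apply hf measurableSet_closedBall]
  refine hn.trans (measure_mono ?_)
  intro x hx
  rw [Metric.mem_closedBall] at hx
  rw [Set.mem_preimage, Metric.mem_closedBall, Real.dist_eq]
  exact (hl x x₀).trans hx

lemma inter_aux {X : Type*} [MeasurableSpace X]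
    (μ : Measure X) [IsProbabilityMeasure μ] (κ κ' : ℝ) (hκ' : 0 < κ') (hκ : κ' < κ)
    (A B : Set X) (hB : MeasurableSet B)
    (hA : ENNReal.ofReal κ ≤ μ A) (hB' : ENNReal.ofReal (1 - κ') ≤ μ B) :
    (A ∩ B).Nonempty := by
  apply nonempty_inter_of_measure_lt_add μ hB (Set.subset_univ A) (Set.subset_univ B)
  rw [measure_univ]
  have h1 : (1 : ENNReal) < ENNReal.ofReal (κ + (1 - κ')) := by
    rw [ENNReal.one_lt_ofReal]; linarith
  exact h1.trans_le (ENNReal.ofReal_add_le.trans (add_le_add hA hB'))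

/-- **Proposition 2.8, second inequality.** `Sep(X;κ,κ) ≤ ObsDiam(X;-κ')`
for `κ > κ' > 0`. -/
theorem sep_le_obsDiam
    {X : Type*} [MetricSpace X] [CompleteSpace X] [TopologicalSpace.SeparableSpace X]
    [MeasurableSpace X] [BorelSpace X]
    (μ : Measure X) [IsProbabilityMeasure μ]
    (κ κ' : ℝ) (hκ' : 0 < κ') (hκ : κ' < κ) :
    sepTwo dist μ κ κ ≤ obsDiam dist μ κ' := by
  obtain ⟨x₀⟩ : Nonempty X := nonempty_of_isProbabilityMeasure μ
  obtain ⟨n, hn⟩ := exists_ball_aux μ x₀ κ' hκ'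
  have hbdd : BddAbove {r : ℝ | ∃ f : X → ℝ, Measurable f ∧
      (∀ x y, |f x - f y| ≤ dist x y) ∧ r = partialDiam (μ.map f) (1 - κ')} := by
    refine ⟨2 * n, ?_⟩
    rintro r ⟨f, hf, hl, rfl⟩
    obtain ⟨h1, h2, h3⟩ := mem_partial_aux μ x₀ κ' n hn f hf hl
    refine le_trans (b := Metric.diam (Metric.closedBall (f x₀) (n : ℝ)))
      (csInf_le ⟨0, ?_⟩ ⟨_, h1, h2, h3, rfl⟩)
      (Metric.diam_closedBall (Nat.cast_nonneg n))
    rintro r ⟨A, -, -, -, rfl⟩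
    exact Metric.diam_nonneg
  unfold sepTwo
  refine csSup_le ⟨(0 : ℝ), Set.mem_union_left _ rfl⟩ ?_
  rintro r (hr | ⟨A₀, A₁, h₀, h₁, hm₀, hm₁, rfl⟩)
  · rw [Set.mem_singleton_iff.1 hr]
    apply Real.sSup_nonneg
    rintro r ⟨f, -, -, rfl⟩
    exact partialDiam_nonneg_aux _ _
  have hl : ∀ x y : X, |Metric.infDist x A₀ - Metric.infDist y A₀| ≤ dist x y := by
    intro x y
    have := (Metric.lipschitz_infDist_pt A₀).dist_le_mul x y
    simpa [Real.dist_eq] using this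
  have hf : Measurable (fun x : X => Metric.infDist x A₀) :=
    (Metric.continuous_infDist_pt A₀).measurable
  refine le_trans ?_ (le_csSup hbdd ⟨_, hf, hl, rfl⟩)
  obtain ⟨g1, g2, g3⟩ := mem_partial_aux μ x₀ κ' n hn _ hf hl
  unfold partialDiam
  refine le_csInf ⟨Metric.diam _, _, g1, g2, g3, rfl⟩ ?_
  rintro r ⟨A, hA, hAb, hAm, rfl⟩
  rw [Measure.map_apply hf hA] at hAm
  obtain ⟨x, hx, hxA⟩ := inter_aux μ κ κ' hκ' hκ A₀ _ (hf hA) hm₀ hAm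
  obtain ⟨y, hy, hyA⟩ := inter_aux μ κ κ' hκ' hκ A₁ _ (hf hA) hm₁ hAm
  have hd := Metric.dist_le_diam_of_mem hAb hyA hxA
  simp only [Metric.infDist_zero_of_mem hx, Real.dist_eq, sub_zero] at hd
  refine le_trans ?_ ((le_abs_self _).trans hd)
  rw [Metric.le_infDist ⟨x, hx⟩]
  intro z hz
  refine csInf_le ⟨0, ?_⟩ ⟨z, hz, y, hy, dist_comm _ _⟩
  rintro r ⟨a, -, b, -, rfl⟩
  exact dist_nonneg
end
end

section
/- Let μ be a Borel probability measure on ℝ with bounded support, mean E and variance V > 0, and let f_n : ℝ^n → ℝ, f_n(x) = Σ_{i=1}^n x_i, regarded as a random variable with respect to the product measure μ^{⊗n}. Fix 0 < κ < 1/2 and define α_n := inf{ x ∈ ℝ : (f_n)_*μ^{⊗n}((-∞, x]) ≥ κ } and β_n := sup{ x ∈ ℝ : (f_n)_*μ^{⊗n}([x, +∞)) ≥ κ }. Then (β_n - α_n)/√(nV) → 2 Φ^{-1}(κ) as n → ∞, where Φ(r) = ∫_r^∞ (2π)^{-1/2} e^{-t²/2} dt and Φ^{-1} is its inverse function on (0,1).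 -/
open MeasureTheory Filter Topology Bornology

noncomputable section

/-- The Gaussian tail function `Φ(r) = ∫_r^∞ (2π)^{-1/2} e^{-t²/2} dt`. -/
def gaussTail (r : ℝ) : ℝ :=
  ∫ t in Set.Ioi r, (Real.sqrt (2 * Real.pi))⁻¹ * Real.exp (-t ^ 2 / 2)

/-- The inverse function `Φ⁻¹` of the Gaussian tail function (on `(0,1)`). -/
def gaussTailInv : ℝ → ℝ := Function.invFun gaussTail

open ProbabilityTheory in
lemma gaussTail_eq (r : ℝ) : gaussTail r = (gaussianReal 0 1).real (Set.Ioi r) := by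
  rw [Measure.real, gaussianReal_apply_eq_integral 0 one_ne_zero, ENNReal.toReal_ofReal]
  · simp [gaussTail, gaussianPDFReal_def]
  · exact integral_nonneg fun x => gaussianPDFReal_nonneg _ _ _

open ProbabilityTheory in
lemma ofReal_gaussTail (r : ℝ) :
    ENNReal.ofReal (gaussTail r) = gaussianReal 0 1 (Set.Ici r) := by
  have := nullSingletonClass_gaussianReal (μ := 0) (v := 1) one_ne_zero
  rw [gaussTail_eq, ofReal_measureReal, Ioi_ae_eq_Ici.measure_eq]

open ProbabilityTheory in
lemma ofReal_gaussTail_neg (r : ℝ) :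
    ENNReal.ofReal (gaussTail (-r)) = gaussianReal 0 1 (Set.Iic r) := by
  rw [ofReal_gaussTail]
  have h : (gaussianReal 0 1).map (fun x ↦ -x) = gaussianReal 0 1 := by
    simpa using gaussianReal_map_neg (μ := 0) (v := 1)
  conv_lhs => rw [← h]
  rw [Measure.map_apply (by fun_prop) measurableSet_Ici]
  congr 1
  ext x
  simp

open ProbabilityTheory in
lemma gaussTail_integrable :
    Integrable (fun t : ℝ => (Real.sqrt (2 * Real.pi))⁻¹ * Real.exp (-t ^ 2 / 2)) := by
  simpa [gaussianPDFReal_def] using integrable_gaussianPDFReal 0 1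

lemma gaussTail_sub (a b : ℝ) : gaussTail a - gaussTail b =
    ∫ t in a..b, (Real.sqrt (2 * Real.pi))⁻¹ * Real.exp (-t ^ 2 / 2) :=
  intervalIntegral.integral_Ioi_sub_Ioi' gaussTail_integrable.integrableOn
    gaussTail_integrable.integrableOn

lemma gaussTail_strictAnti : StrictAnti gaussTail := by
  intro a b hab
  have := gaussTail_sub a b
  have h2 : 0 < ∫ t in a..b, (Real.sqrt (2 * Real.pi))⁻¹ * Real.exp (-t ^ 2 / 2) :=
    intervalIntegral.intervalIntegral_pos_of_pos gaussTail_integrable.intervalIntegrable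
      (fun x => by positivity) hab
  linarith

lemma gaussTail_continuous : Continuous gaussTail := by
  have h : gaussTail = fun b => gaussTail 0 -
      ∫ t in (0:ℝ)..b, (Real.sqrt (2 * Real.pi))⁻¹ * Real.exp (-t ^ 2 / 2) := by
    ext b
    rw [← gaussTail_sub]; ring
  rw [h]
  exact continuous_const.sub
    (intervalIntegral.continuous_primitive (fun a b => gaussTail_integrable.intervalIntegrable) 0)

open ProbabilityTheory in
lemma gaussTail_eq_cdf (r : ℝ) : gaussTail r = 1 - cdf (gaussianReal 0 1) r := by
  rw [cdf_eq_real, gaussTail_eq, ← Set.compl_Iic, probReal_compl_eq_one_sub measurableSet_Iic]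

open ProbabilityTheory in
lemma gaussTail_gaussTailInv {κ : ℝ} (h0 : 0 < κ) (h1 : κ < 1) :
    gaussTail (gaussTailInv κ) = κ := by
  apply Function.invFun_eq
  have ht : Tendsto gaussTail atTop (𝓝 0) := by
    have := (tendsto_cdf_atTop (gaussianReal 0 1)).const_sub 1
    simpa [funext gaussTail_eq_cdf] using this
  have hb : Tendsto gaussTail atBot (𝓝 1) := by
    have := (tendsto_cdf_atBot (gaussianReal 0 1)).const_sub 1
    simpa [funext gaussTail_eq_cdf] using this
  obtain ⟨a, ha⟩ := (ht.eventually_lt_const h0).exists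
  obtain ⟨b, hb⟩ := (hb.eventually_const_lt h1).exists
  exact mem_range_of_exists_le_of_exists_ge gaussTail_continuous ⟨a, ha.le⟩ ⟨b, hb.le⟩

/-- The law of the sum. -/
def sumLaw (μ : Measure ℝ) (n : ℕ) : Measure ℝ :=
  Measure.map (fun v : Fin n → ℝ => ∑ i, v i) (Measure.pi fun _ : Fin n => μ)

open ProbabilityTheory in
lemma sumLaw_eq (μ : Measure ℝ) [IsProbabilityMeasure μ] (n : ℕ) :
    sumLaw μ n = (Measure.infinitePi (fun _ : ℕ => μ)).map
      (fun ω => ∑ k ∈ Finset.range n, ω k) := by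
  have h := Measure.map_infinitePi_infinitePi_of_inj (P := fun _ : ℕ => μ)
    (f := fun i : Fin n => (i : ℕ)) Fin.val_injective
  rw [Measure.infinitePi_eq_pi (ι := Fin n)] at h
  rw [sumLaw, ← h, Measure.map_map (by fun_prop) (by fun_prop)]
  congr 1
  ext ω
  simp [Finset.sum_range]

open ProbabilityTheory in
lemma clt_set (μ : Measure ℝ) [IsProbabilityMeasure μ]
    (hintg : Integrable (fun x : ℝ => x) μ)
    (E V : ℝ) (hE : ∫ x, x ∂μ = E) (hV : ∫ x, (x - E) ^ 2 ∂μ = V) (hVpos : 0 < V)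
    (S : Set ℝ) (hS : MeasurableSet S) (hfr : gaussianReal 0 1 (frontier S) = 0) :
    Tendsto (fun n : ℕ => sumLaw μ n ((fun x => (√(n * V))⁻¹ * (x - n * E)) ⁻¹' S)) atTop
      (𝓝 (gaussianReal 0 1 S)) := by
  set P := Measure.infinitePi (fun _ : ℕ => μ)
  let X : ℕ → (ℕ → ℝ) → ℝ := fun k ω => (ω k - E) / √V
  have hmp (k : ℕ) : MeasurePreserving (fun ω : ℕ → ℝ => ω k) P μ :=
    measurePreserving_eval_infinitePi (fun _ : ℕ => μ) k
  have hind : iIndepFun X P :=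
    iIndepFun_infinitePi (P := fun _ : ℕ => μ) (X := fun _ x => (x - E) / √V) (by fun_prop)
  have hid (k : ℕ) : IdentDistrib (X k) (X 0) P P := by
    have : IdentDistrib (fun ω : ℕ → ℝ => ω k) (fun ω : ℕ → ℝ => ω 0) P P :=
      ⟨(hmp k).aemeasurable, (hmp 0).aemeasurable, by rw [(hmp k).map_eq, (hmp 0).map_eq]⟩
    exact this.comp (u := fun x => (x - E) / √V) (by fun_prop)
  have h0 : P[X 0] = 0 := by
    have h : ∫ ω, (fun x => (x - E) / √V) (ω 0) ∂P = ∫ x, (x - E) / √V ∂μ := by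
      rw [← (hmp 0).map_eq, integral_map (hmp 0).aemeasurable (by fun_prop)]
    refine h.trans ?_
    rw [integral_div, integral_sub hintg (by simp), hE]
    simp
  have h1 : P[X 0 ^ 2] = 1 := by
    have h : ∫ ω, (fun x => ((x - E) / √V) ^ 2) (ω 0) ∂P = ∫ x, ((x - E) / √V) ^ 2 ∂μ := by
      rw [← (hmp 0).map_eq, integral_map (hmp 0).aemeasurable (by fun_prop)]
    refine h.trans ?_
    simp only [div_pow]
    rw [integral_div, hV, Real.sq_sqrt hVpos.le, div_self hVpos.ne']
  have clt := tendstoInDistribution_inv_sqrt_mul_sum (Y := id) (P' := gaussianReal 0 1)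
    HasLaw.id h0 h1 hind hid
  have key := ProbabilityMeasure.tendsto_measure_of_null_frontier_of_tendsto' clt.tendsto
    (E := S) (by simpa using hfr)
  simp only [ProbabilityMeasure.coe_mk, Measure.map_id] at key
  refine key.congr fun n => ?_
  rw [sumLaw_eq, Measure.map_apply (by fun_prop) hS,
    Measure.map_apply (by fun_prop) (hS.preimage (by fun_prop)), ← Set.preimage_comp]
  congr 2
  ext ω
  simp only [X, Function.comp, ← Finset.sum_div, Finset.sum_sub_distrib]
  simp [Real.sqrt_mul]
  ring

open ProbabilityTheory in
lemma clt_Ici (μ : Measure ℝ) [IsProbabilityMeasure μ]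
    (hintg : Integrable (fun x : ℝ => x) μ)
    (E V : ℝ) (hE : ∫ x, x ∂μ = E) (hV : ∫ x, (x - E) ^ 2 ∂μ = V) (hVpos : 0 < V) (r : ℝ) :
    Tendsto (fun n : ℕ => sumLaw μ n (Set.Ici (n * E + r * √(n * V)))) atTop
      (𝓝 (ENNReal.ofReal (gaussTail r))) := by
  have := nullSingletonClass_gaussianReal (μ := 0) (v := 1) one_ne_zero
  rw [ofReal_gaussTail]
  refine (clt_set μ hintg E V hE hV hVpos (Set.Ici r) measurableSet_Ici (by simp)).congr' ?_
  filter_upwards [eventually_gt_atTop 0] with n hn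
  have hs : 0 < √(n * V) := by positivity
  congr 1
  ext x
  simp only [Set.mem_preimage, Set.mem_Ici]
  rw [inv_mul_eq_div, le_div_iff₀ hs, le_sub_iff_add_le']

open ProbabilityTheory in
lemma clt_Iic (μ : Measure ℝ) [IsProbabilityMeasure μ]
    (hintg : Integrable (fun x : ℝ => x) μ)
    (E V : ℝ) (hE : ∫ x, x ∂μ = E) (hV : ∫ x, (x - E) ^ 2 ∂μ = V) (hVpos : 0 < V) (r : ℝ) :
    Tendsto (fun n : ℕ => sumLaw μ n (Set.Iic (n * E + r * √(n * V)))) atTop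
      (𝓝 (ENNReal.ofReal (gaussTail (-r)))) := by
  have := nullSingletonClass_gaussianReal (μ := 0) (v := 1) one_ne_zero
  rw [ofReal_gaussTail_neg]
  refine (clt_set μ hintg E V hE hV hVpos (Set.Iic r) measurableSet_Iic (by simp)).congr' ?_
  filter_upwards [eventually_gt_atTop 0] with n hn
  have hs : 0 < √(n * V) := by positivity
  congr 1
  ext x
  simp only [Set.mem_preimage, Set.mem_Iic]
  rw [inv_mul_eq_div, div_le_iff₀ hs, sub_le_iff_le_add']

/-- Let `μ` be a Borel probability measure on `ℝ` with bounded support, mean `E` and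
variance `V > 0`, and let `f_n(x) = ∑ x_i` on `ℝ^n` with the product measure `μ^{⊗n}`.
With `α_n = inf{x : (f_n)_*μ^{⊗n}((-∞,x]) ≥ κ}` and
`β_n = sup{x : (f_n)_*μ^{⊗n}([x,∞)) ≥ κ}` for a fixed `0 < κ < 1/2`, one has
`(β_n - α_n)/√(nV) → 2 Φ⁻¹(κ)` as `n → ∞`. -/
theorem quantile_gap_tendsto_two_gaussTailInv
    (μ : Measure ℝ) [IsProbabilityMeasure μ]
    (hsupp : ∃ s : Set ℝ, IsBounded s ∧ μ sᶜ = 0)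
    (E V : ℝ) (hE : ∫ x, x ∂μ = E) (hV : ∫ x, (x - E) ^ 2 ∂μ = V) (hVpos : 0 < V)
    (κ : ℝ) (hκ0 : 0 < κ) (hκhalf : κ < 1 / 2) :
    Filter.Tendsto (fun n : ℕ =>
      (sSup {x : ℝ | ENNReal.ofReal κ ≤
          (Measure.map (fun v : Fin n → ℝ => ∑ i, v i)
            (Measure.pi fun _ : Fin n => μ)) (Set.Ici x)} -
        sInf {x : ℝ | ENNReal.ofReal κ ≤
          (Measure.map (fun v : Fin n → ℝ => ∑ i, v i)
            (Measure.pi fun _ : Fin n => μ)) (Set.Iic x)}) /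
        Real.sqrt (n * V)) atTop (𝓝 (2 * gaussTailInv κ)) := by
  have hintg : Integrable (fun x : ℝ => x) μ := by
    obtain ⟨s, hs, hμ⟩ := hsupp
    obtain ⟨C, hC⟩ := hs.exists_norm_le
    refine Integrable.of_bound (by fun_prop) C ?_
    have : ∀ᵐ x ∂μ, x ∈ s := hμ
    filter_upwards [this] with x hx using hC x hx
  set q := gaussTailInv κ with hq
  have hκ : gaussTail q = κ := gaussTail_gaussTailInv hκ0 (by linarith)
  have hb : Tendsto (fun n : ℕ => (sSup {x : ℝ | ENNReal.ofReal κ ≤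
      sumLaw μ n (Set.Ici x)} - n * E) / √(n * V)) atTop (𝓝 q) := by
    rw [Metric.tendsto_nhds]
    intro ε hε
    have hlo : κ < gaussTail (q - ε / 2) := by
      rw [← hκ]; exact gaussTail_strictAnti (by linarith)
    have hhi : gaussTail (q + ε / 2) < κ := by
      rw [← hκ]; exact gaussTail_strictAnti (by linarith)
    have e1 := (clt_Ici μ hintg E V hE hV hVpos (q - ε / 2)).eventually_const_lt
      ((ENNReal.ofReal_lt_ofReal_iff (hκ0.trans hlo)).2 hlo)
    have e2 := (clt_Ici μ hintg E V hE hV hVpos (q + ε / 2)).eventually_lt_const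
      ((ENNReal.ofReal_lt_ofReal_iff hκ0).2 hhi)
    filter_upwards [e1, e2, eventually_gt_atTop 0] with n h1 h2 hn
    have hs : 0 < √(n * V) := by positivity
    have hmem : n * E + (q - ε / 2) * √(n * V) ∈
        {x : ℝ | ENNReal.ofReal κ ≤ sumLaw μ n (Set.Ici x)} := h1.le
    have hub : ∀ x ∈ {x : ℝ | ENNReal.ofReal κ ≤ sumLaw μ n (Set.Ici x)},
        x ≤ n * E + (q + ε / 2) * √(n * V) := by
      intro x hx
      by_contra! hlt
      exact absurd ((show ENNReal.ofReal κ ≤ _ from hx).trans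
        (measure_mono (Set.Ici_subset_Ici.2 hlt.le))) (not_le.2 h2)
    have hle := le_csSup ⟨_, hub⟩ hmem
    have hge := csSup_le ⟨_, hmem⟩ hub
    rw [Real.dist_eq, abs_lt, lt_sub_iff_add_lt, sub_lt_iff_lt_add, lt_div_iff₀ hs, div_lt_iff₀ hs]
    constructor <;> nlinarith
  have ha : Tendsto (fun n : ℕ => (sInf {x : ℝ | ENNReal.ofReal κ ≤
      sumLaw μ n (Set.Iic x)} - n * E) / √(n * V)) atTop (𝓝 (-q)) := by
    rw [Metric.tendsto_nhds]
    intro ε hε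
    have hlo : κ < gaussTail (-(-q + ε / 2)) := by
      rw [← hκ]; exact gaussTail_strictAnti (by linarith)
    have hhi : gaussTail (-(-q - ε / 2)) < κ := by
      rw [← hκ]; exact gaussTail_strictAnti (by linarith)
    have e1 := (clt_Iic μ hintg E V hE hV hVpos (-q + ε / 2)).eventually_const_lt
      ((ENNReal.ofReal_lt_ofReal_iff (hκ0.trans hlo)).2 hlo)
    have e2 := (clt_Iic μ hintg E V hE hV hVpos (-q - ε / 2)).eventually_lt_const
      ((ENNReal.ofReal_lt_ofReal_iff hκ0).2 hhi)
    filter_upwards [e1, e2, eventually_gt_atTop 0] with n h1 h2 hn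
    have hs : 0 < √(n * V) := by positivity
    have hmem : n * E + (-q + ε / 2) * √(n * V) ∈
        {x : ℝ | ENNReal.ofReal κ ≤ sumLaw μ n (Set.Iic x)} := h1.le
    have hlb : ∀ x ∈ {x : ℝ | ENNReal.ofReal κ ≤ sumLaw μ n (Set.Iic x)},
        n * E + (-q - ε / 2) * √(n * V) ≤ x := by
      intro x hx
      by_contra! hlt
      exact absurd ((show ENNReal.ofReal κ ≤ _ from hx).trans
        (measure_mono (Set.Iic_subset_Iic.2 hlt.le))) (not_le.2 h2)
    have hle := csInf_le ⟨_, hlb⟩ hmem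
    have hge := le_csInf ⟨_, hmem⟩ hlb
    rw [Real.dist_eq, abs_lt, lt_sub_iff_add_lt, sub_lt_iff_lt_add, lt_div_iff₀ hs, div_lt_iff₀ hs]
    constructor <;> nlinarith
  have := hb.sub ha
  rw [show q - -q = 2 * q by ring] at this
  refine this.congr fun n => ?_
  rw [← sub_div]
  congr 1
  simp only [sumLaw]
  ring
end
end
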